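/- Let G be a directed graph with proper boundaries and let P = {P₁,…,P_λ} be a maximum st-flow in G whose reachability pattern has only self-loops. Then for every star st-cut Z of G exactly one of the following two alternatives holds: (1) there exists an index i ∈ {1,…,λ} such that no arc of Z lying on P_i is a bottleneck arc, and |core(Z)| > λ (core(Z) is not a minimum st-cut); (2) |core(Z)| = λ, so core(Z) is a minimum st-cut of G, and no arc of Z ∖ core(Z) is a bottleneck arc of G. -/

import Mathlib

open scoped Classical

namespace FlowAug

variable {V : Type}

/-- Reachability from `a` to `b` using arcs in `A`. -/
def Reach (A : Set (V × V)) (a b : V) : Prop :=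
  Relation.ReflTransGen (fun u v => (u, v) ∈ A) a b

/-- `Z` is an `st`-cut of the directed graph with arc set `E`. -/
def IsCut (E : Finset (V × V)) (s t : V) (Z : Finset (V × V)) : Prop :=
  Z ⊆ E ∧ ¬ Reach ((E : Set (V × V)) \ (Z : Set (V × V))) s t

/-- A minimal `st`-cut: no proper subset is an `st`-cut. -/
def IsMinimalCut (E : Finset (V × V)) (s t : V) (Z : Finset (V × V)) : Prop :=
  IsCut E s t Z ∧ ∀ Z', Z' ⊂ Z → ¬ IsCut E s t Z'

/-- A minimum `st`-cut: of minimum cardinality among all `st`-cuts. -/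
def IsMinCut (E : Finset (V × V)) (s t : V) (Z : Finset (V × V)) : Prop :=
  IsCut E s t Z ∧ ∀ Z', IsCut E s t Z' → Z.card ≤ Z'.card

/-- `Z ⊆ E` is an `st`-cut of the augmented graph `G + A`. -/
def IsCutAug (E A : Finset (V × V)) (s t : V) (Z : Finset (V × V)) : Prop :=
  Z ⊆ E ∧ ¬ Reach (((E : Set (V × V)) \ (Z : Set (V × V))) ∪ (A : Set (V × V))) s t

/-- A minimum `st`-cut of the augmented graph `G + A`. -/
def IsMinCutAug (E A : Finset (V × V)) (s t : V) (Z : Finset (V × V)) : Prop :=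
  IsCutAug E A s t Z ∧ ∀ Z', IsCutAug E A s t Z' → Z.card ≤ Z'.card

/-- The `s`-side of the cut `Z`: vertices reachable from `s` using arcs of `E \ Z`. -/
def sSide (E : Finset (V × V)) (s : V) (Z : Finset (V × V)) : Set V :=
  {v | Reach ((E : Set (V × V)) \ (Z : Set (V × V))) s v}

/-- A star `st`-cut: every arc of `Z` has tail in the `s`-side and head in the `t`-side. -/
def IsStarCut (E : Finset (V × V)) (s t : V) (Z : Finset (V × V)) : Prop :=
  IsCut E s t Z ∧ ∀ e ∈ Z, e.1 ∈ sSide E s Z ∧ e.2 ∉ sSide E s Z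

/-- `A` is compatible with the star `st`-cut `Z`: no arc of `A` goes from the
`s`-side of `Z` to the `t`-side of `Z`. -/
def Compatible (E : Finset (V × V)) (s : V) (Z A : Finset (V × V)) : Prop :=
  ∀ e ∈ A, e.1 ∈ sSide E s Z → e.2 ∈ sSide E s Z

/-- `core_{G+A}(Z)`: arcs of `Z` whose head reaches `t` via arcs of `(E \ Z) ∪ A`. -/
noncomputable def coreAug (E A Z : Finset (V × V)) (t : V) : Finset (V × V) :=
  Z.filter (fun e =>
    Reach (((E : Set (V × V)) \ (Z : Set (V × V))) ∪ (A : Set (V × V))) e.2 t)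

/-- `core(Z)`: arcs of `Z` whose head reaches `t` via arcs of `E \ Z`. -/
noncomputable def core (E Z : Finset (V × V)) (t : V) : Finset (V × V) :=
  Z.filter (fun e => Reach ((E : Set (V × V)) \ (Z : Set (V × V))) e.2 t)

/-- `δ⁺(X)`: arcs of `E` with tail in `X` and head outside `X`. -/
noncomputable def deltaPlus (E : Finset (V × V)) (X : Set V) : Finset (V × V) :=
  E.filter (fun e => e.1 ∈ X ∧ e.2 ∉ X)

/-- The arcs traversed by a walk given by its list of vertices. -/
def arcsOf (p : List V) : List (V × V) := p.zip p.tail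

/-- `p` is a directed path from `s` to `t` using arcs of `A`. -/
def IsPathIn (A : Set (V × V)) (s t : V) (p : List V) : Prop :=
  p.Chain' (fun u v => (u, v) ∈ A) ∧ p.head? = some s ∧ p.getLast? = some t

/-- The paths `P i` are pairwise arc-disjoint. -/
def ArcDisjoint {lam : ℕ} (P : Fin lam → List V) : Prop :=
  ∀ i j, i ≠ j → ∀ e : V × V, ¬ (e ∈ arcsOf (P i) ∧ e ∈ arcsOf (P j))

/-- An `st`-flow: a family of pairwise arc-disjoint directed `st`-paths in `G`. -/
def IsFlow (E : Finset (V × V)) (s t : V) {lam : ℕ} (P : Fin lam → List V) : Prop :=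
  (∀ i, IsPathIn (E : Set (V × V)) s t (P i)) ∧ ArcDisjoint P

/-- A maximum `st`-flow: the number of paths equals the minimum cardinality of an `st`-cut. -/
def IsMaxFlow (E : Finset (V × V)) (s t : V) {lam : ℕ} (P : Fin lam → List V) : Prop :=
  IsFlow E s t P ∧ ∃ Z, IsMinCut E s t Z ∧ Z.card = lam

/-- Arcs of the residual graph `G^P`. -/
def ResArc (E : Finset (V × V)) {lam : ℕ} (P : Fin lam → List V) (u v : V) : Prop :=
  ((u, v) ∈ E ∧ ∀ i, (u, v) ∉ arcsOf (P i)) ∨ (∃ i, (v, u) ∈ arcsOf (P i))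

/-- Reachability in the residual graph `G^P`. -/
def ResReach (E : Finset (V × V)) {lam : ℕ} (P : Fin lam → List V) : V → V → Prop :=
  Relation.ReflTransGen (ResArc E P)

/-- `G` has proper boundaries: `δ⁺({s})` and `δ⁻({t})` are minimum `st`-cuts
and there is no arc `(s, t)`. -/
def ProperBoundaries [DecidableEq V] (E : Finset (V × V)) (s t : V) : Prop :=
  IsMinCut E s t (E.filter (fun e => e.1 = s)) ∧
  IsMinCut E s t (E.filter (fun e => e.2 = t)) ∧ (s, t) ∉ E

/-- The reachability pattern of `(G, P)` has only self-loops: no residual path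
between internal vertices of distinct flow paths. -/
def OnlySelfLoops (E : Finset (V × V)) (s t : V) {lam : ℕ} (P : Fin lam → List V) : Prop :=
  ∀ i j : Fin lam, i ≠ j → ∀ u ∈ P i, u ≠ s → u ≠ t → ∀ v ∈ P j, v ≠ s → v ≠ t →
    ¬ ResReach E P u v

/-- A bottleneck arc: an arc contained in some minimum `st`-cut. -/
def Bottleneck (E : Finset (V × V)) (s t : V) (e : V × V) : Prop :=
  ∃ Z, IsMinCut E s t Z ∧ e ∈ Z

/-- A witnessing flow for the star `st`-cut `Z` in `G + A`: `|core_{G+A}(Z)|`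
`st`-paths in `G + A`, pairwise sharing no arc of `E \ A`, each containing
exactly one arc of `core_{G+A}(Z)` and no arc of `Z \ core_{G+A}(Z)`. -/
def WitnessingFlow (E A Z : Finset (V × V)) (s t : V) : Prop :=
  ∃ P : Fin (coreAug E A Z t).card → List V,
    (∀ i, IsPathIn ((E : Set (V × V)) ∪ (A : Set (V × V))) s t (P i)) ∧
    (∀ i j, i ≠ j → ∀ e : V × V, e ∈ arcsOf (P i) → e ∈ arcsOf (P j) →
      e ∉ ((E : Set (V × V)) \ (A : Set (V × V)))) ∧
    (∀ i, ∃! e : V × V, e ∈ coreAug E A Z t ∧ e ∈ arcsOf (P i)) ∧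
    (∀ i, ∀ e ∈ arcsOf (P i), e ∈ Z → e ∈ coreAug E A Z t)

theorem mem_of_mem_arcsOf {p : List V} {u v : V} (h : (u, v) ∈ arcsOf p) : u ∈ p ∧ v ∈ p :=
  ⟨(List.of_mem_zip h).1, List.mem_of_mem_tail (List.of_mem_zip h).2⟩

theorem IsPathIn.reach_diff {A Z : Set (V × V)} {t : V} {p : List V} {s : V}
    (hp : IsPathIn A s t p) (hZ : ∀ e ∈ arcsOf p, e ∉ Z) : Reach (A \ Z) s t := by
  obtain ⟨hc, hh, hl⟩ := hp
  induction p generalizing s with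
  | nil => simp at hh
  | cons a q ih =>
    obtain rfl : a = s := by simpa using hh
    cases q with
    | nil =>
      obtain rfl : a = t := by simpa using hl
      exact Relation.ReflTransGen.refl
    | cons b r =>
      have hab : (a, b) ∈ A ∧ (b :: r).IsChain (fun u v => (u, v) ∈ A) :=
        List.isChain_cons_cons.mp hc
      have hbt : Reach (A \ Z) b t :=
        ih (fun e he => hZ e (by simp only [arcsOf, List.tail_cons, List.zip_cons_cons,
          List.mem_cons] at he ⊢; exact Or.inr he)) hab.2 rfl (by simpa using hl)
      exact Relation.ReflTransGen.head ⟨hab.1, hZ _ (by simp [arcsOf])⟩ hbt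

/-- Every path meets every cut. -/
theorem IsCut.exists_mem_arcsOf {E Z : Finset (V × V)} {s t : V} {p : List V}
    (hZ : IsCut E s t Z) (hp : IsPathIn (E : Set (V × V)) s t p) : ∃ e ∈ arcsOf p, e ∈ Z := by
  by_contra! h
  exact hZ.2 (hp.reach_diff fun e he => by simpa using h e he)

theorem IsMinCut.card_eq {E Z Z' : Finset (V × V)} {s t : V}
    (hZ : IsMinCut E s t Z) (hZ' : IsMinCut E s t Z') : Z.card = Z'.card :=
  le_antisymm (hZ.2 _ hZ'.1) (hZ'.2 _ hZ.1)

/-- The paths of a maximum flow correspond bijectively to the arcs of a minimum cut. -/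
theorem IsMaxFlow.exists_equiv {E C : Finset (V × V)} {s t : V} {lam : ℕ}
    {P : Fin lam → List V} (hP : IsMaxFlow E s t P) (hC : IsMinCut E s t C) :
    ∃ f : Fin lam ≃ C, ∀ i, (f i : V × V) ∈ arcsOf (P i) := by
  obtain ⟨⟨hpath, hdisj⟩, Z, hZ, rfl⟩ := hP
  choose f hfP hfC using fun i => hC.1.exists_mem_arcsOf (hpath i)
  let g : Fin Z.card → C := fun i => ⟨f i, hfC i⟩
  have hg : Function.Injective g := by
    intro i j hij
    by_contra hne
    have hfij : f i = f j := congrArg Subtype.val hij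
    exact hdisj i j hne (f i) ⟨hfP i, hfij ▸ hfP j⟩
  have hgb : Function.Bijective g :=
    (Fintype.bijective_iff_injective_and_card g).2 ⟨hg, by simp [hZ.card_eq hC]⟩
  exact ⟨Equiv.ofBijective g hgb, hfP⟩

theorem IsMaxFlow.exists_mem_arcsOf {E C : Finset (V × V)} {s t : V} {lam : ℕ}
    {P : Fin lam → List V} (hP : IsMaxFlow E s t P) (hC : IsMinCut E s t C)
    {e : V × V} (he : e ∈ C) : ∃ i, e ∈ arcsOf (P i) := by
  obtain ⟨f, hf⟩ := hP.exists_equiv hC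
  refine ⟨f.symm ⟨e, he⟩, ?_⟩
  simpa using hf (f.symm ⟨e, he⟩)

theorem IsMaxFlow.eq_of_mem_arcsOf {E C : Finset (V × V)} {s t : V} {lam : ℕ}
    {P : Fin lam → List V} (hP : IsMaxFlow E s t P) (hC : IsMinCut E s t C) {i : Fin lam}
    {e e' : V × V} (he : e ∈ C) (he' : e' ∈ C) (hei : e ∈ arcsOf (P i))
    (hei' : e' ∈ arcsOf (P i)) : e = e' := by
  obtain ⟨f, hf⟩ := hP.exists_equiv hC
  have key : ∀ a (ha : a ∈ C), a ∈ arcsOf (P i) → f i = ⟨a, ha⟩ := by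
    intro a ha hai
    obtain ⟨j, hj⟩ := f.surjective ⟨a, ha⟩
    have haj : a ∈ arcsOf (P j) := by simpa [hj] using hf j
    by_cases hij : i = j
    · rw [hij, hj]
    · exact (hP.1.2 i j hij a ⟨hai, haj⟩).elim
  exact congrArg Subtype.val ((key e he hei).symm.trans (key e' he' hei'))

theorem mem_of_leaves_sSide {E Z : Finset (V × V)} {s u v : V} (huv : (u, v) ∈ E)
    (hu : u ∈ sSide E s Z) (hv : v ∉ sSide E s Z) : (u, v) ∈ Z := by
  by_contra h
  exact hv (Relation.ReflTransGen.tail hu ⟨by simpa using huv, by simpa using h⟩)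

/-- When the reachability pattern has only self-loops, choosing one bottleneck arc on each flow
path gives a cut. -/
theorem not_reach_of_bottleneck_choice [DecidableEq V] {E : Finset (V × V)} {s t : V}
    (hst : s ≠ t) (hpb : ProperBoundaries E s t) {lam : ℕ} {P : Fin lam → List V}
    (hP : IsMaxFlow E s t P) (hself : OnlySelfLoops E s t P) {e : Fin lam → V × V}
    (heP : ∀ i, e i ∈ arcsOf (P i)) (heB : ∀ i, Bottleneck E s t (e i)) :
    ¬ Reach ((E : Set (V × V)) \ Set.range e) s t := by
  choose C hC heC using heB
  have hs : ∀ k, s ∈ sSide E s (C k) := fun k => Relation.ReflTransGen.refl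
  have ht : ∀ k, t ∉ sSide E s (C k) := fun k => (hC k).1.2
  have inv : ∀ v, Reach ((E : Set (V × V)) \ Set.range e) s v →
      v = s ∨ ∃ k, v ∈ sSide E s (C k) ∧ ∃ x ∈ P k, x ≠ s ∧ x ≠ t ∧ ResReach E P x v := by
    intro v hv
    induction hv with
    | refl => exact Or.inl rfl
    | @tail v w _ hvw ih =>
      have hvwE : (v, w) ∈ E := hvw.1
      by_cases hws : w = s
      · exact Or.inl hws
      refine Or.inr ?_
      have hstay : ∀ k, v ∈ sSide E s (C k) →
          (∀ j, (v, w) ∈ arcsOf (P j) → j = k) → w ∈ sSide E s (C k) := by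
        intro k hvk hjk
        by_contra hwk
        have hm := mem_of_leaves_sSide hvwE hvk hwk
        obtain ⟨j, hj⟩ := hP.exists_mem_arcsOf (hC k) hm
        obtain rfl := hjk j hj
        exact hvw.2 ⟨j, (hP.eq_of_mem_arcsOf (hC j) hm (heC j) hj (heP j)).symm⟩
      by_cases hvs : v = s
      · subst hvs
        obtain ⟨j, hj⟩ := hP.exists_mem_arcsOf hpb.1 (e := (v, w)) (by simp [hvwE])
        have hwj : w ∈ sSide E v (C j) := hstay j (hs j) fun i hi => by
          by_contra hne
          exact hP.1.2 i j hne _ ⟨hi, hj⟩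
        exact ⟨j, hwj, w, (mem_of_mem_arcsOf hj).2, hws, fun h => ht j (h ▸ hwj),
          Relation.ReflTransGen.refl⟩
      · obtain ⟨k, hvk, x, hx, hxs, hxt, hxv⟩ := ih.resolve_left hvs
        have hvt : v ≠ t := fun h => ht k (h ▸ hvk)
        have huniq : ∀ j, (v, w) ∈ arcsOf (P j) → j = k := by
          intro j hj
          by_contra hne
          exact hself k j (Ne.symm hne) x hx hxs hxt v (mem_of_mem_arcsOf hj).1 hvs hvt hxv
        have hwk := hstay k hvk huniq
        refine ⟨k, hwk, ?_⟩
        by_cases hflow : ∃ j, (v, w) ∈ arcsOf (P j)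
        · obtain ⟨j, hj⟩ := hflow
          obtain rfl := huniq j hj
          exact ⟨w, (mem_of_mem_arcsOf hj).2, hws, fun h => ht j (h ▸ hwk),
            Relation.ReflTransGen.refl⟩
        · exact ⟨x, hx, hxs, hxt, hxv.tail (Or.inl ⟨hvwE, not_exists.1 hflow⟩)⟩
  intro hr
  rcases inv t hr with h | ⟨k, hk, -⟩
  · exact hst h.symm
  · exact ht k hk

/-- The core of a cut is a cut. -/
theorem IsCut.core {E Z : Finset (V × V)} {s t : V} (hZ : IsCut E s t Z) :
    IsCut E s t (core E Z t) := by
  refine ⟨(Finset.filter_subset _ _).trans hZ.1, fun hr => hZ.2 ?_⟩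
  clear hZ
  induction hr using Relation.ReflTransGen.head_induction_on with
  | refl => exact Relation.ReflTransGen.refl
  | @head a b hab _ ih =>
    refine Relation.ReflTransGen.head ⟨hab.1, fun hm => hab.2 ?_⟩ ih
    exact Finset.mem_filter.2 ⟨hm, ih⟩

/-- For a star cut, every subset of arcs that is a cut contains the core. -/
theorem IsStarCut.mem_of_mem_core {E Z : Finset (V × V)} {s t : V} (hZ : IsStarCut E s t Z)
    {C : Set (V × V)} (hCZ : C ⊆ Z) (hC : ¬ Reach ((E : Set (V × V)) \ C) s t)
    {f : V × V} (hf : f ∈ FlowAug.core E Z t) : f ∈ C := by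
  by_contra hfC
  obtain ⟨hfZ, hft⟩ := Finset.mem_filter.1 hf
  have mono : ∀ {a b}, Reach ((E : Set (V × V)) \ (Z : Set (V × V))) a b →
      Reach ((E : Set (V × V)) \ C) a b :=
    fun h => Relation.ReflTransGen.mono (fun _ _ h => ⟨h.1, fun h' => h.2 (hCZ h')⟩) _ _ h
  have hsf : Reach ((E : Set (V × V)) \ C) s f.1 := mono (hZ.2 f hfZ).1
  exact hC ((hsf.tail ⟨hZ.1.1 hfZ, hfC⟩).trans (mono hft))

/-- If every flow path carries a bottleneck arc of the star cut `Z`, any choice of one such arc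
per path enumerates the core of `Z`. -/
theorem core_eq_of_bottleneck_choice [DecidableEq V] {E Z : Finset (V × V)} {s t : V}
    (hst : s ≠ t) (hpb : ProperBoundaries E s t) {lam : ℕ} {P : Fin lam → List V}
    (hP : IsMaxFlow E s t P) (hself : OnlySelfLoops E s t P) (hZ : IsStarCut E s t Z)
    {e : Fin lam → V × V} (heZ : ∀ i, e i ∈ Z) (heP : ∀ i, e i ∈ arcsOf (P i))
    (heB : ∀ i, Bottleneck E s t (e i)) :
    core E Z t = Finset.univ.image e := by
  have hcut := not_reach_of_bottleneck_choice hst hpb hP hself heP heB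
  refine Finset.eq_of_subset_of_card_le (fun f hf => ?_) ?_
  · simpa using hZ.mem_of_mem_core (C := Set.range e) (by rintro _ ⟨i, rfl⟩; exact heZ i) hcut hf
  · obtain ⟨-, Z', hZ', rfl⟩ := hP
    calc (Finset.univ.image e).card ≤ Finset.card (Finset.univ : Finset (Fin Z'.card)) :=
          Finset.card_image_le
      _ = Z'.card := by simp
      _ ≤ (core E Z t).card := hZ'.2 _ hZ.1.core

/-- Lemma `lem:base-case`: with proper boundaries and a self-loops-only
reachability pattern, for every star `st`-cut `Z` exactly one of the two
alternatives holds. -/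
theorem base_case_dichotomy (V : Type) [Fintype V] [DecidableEq V]
    (E : Finset (V × V)) (s t : V) (hst : s ≠ t)
    (hpb : ProperBoundaries E s t)
    (lam : ℕ) (P : Fin lam → List V) (hP : IsMaxFlow E s t P)
    (hself : OnlySelfLoops E s t P)
    (Z : Finset (V × V)) (hZ : IsStarCut E s t Z) :
    (((∃ i : Fin lam, ∀ f ∈ Z, f ∈ arcsOf (P i) → ¬ Bottleneck E s t f) ∧
        lam < (core E Z t).card) ∧
      ¬ ((core E Z t).card = lam ∧ IsMinCut E s t (core E Z t) ∧
          ∀ f ∈ Z, f ∉ core E Z t → ¬ Bottleneck E s t f)) ∨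
    (¬ ((∃ i : Fin lam, ∀ f ∈ Z, f ∈ arcsOf (P i) → ¬ Bottleneck E s t f) ∧
          lam < (core E Z t).card) ∧
      ((core E Z t).card = lam ∧ IsMinCut E s t (core E Z t) ∧
        ∀ f ∈ Z, f ∉ core E Z t → ¬ Bottleneck E s t f)) := by
  have hcore : IsCut E s t (core E Z t) := hZ.1.core
  obtain ⟨Z', hZ', hcard⟩ := hP.2
  have hle : lam ≤ (core E Z t).card := hcard ▸ hZ'.2 _ hcore
  have hmin : (core E Z t).card = lam → IsMinCut E s t (core E Z t) := fun h =>
    ⟨hcore, fun W hW => by rw [h, ← hcard]; exact hZ'.2 W hW⟩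
  by_cases hi : ∃ i : Fin lam, ∀ f ∈ Z, f ∈ arcsOf (P i) → ¬ Bottleneck E s t f
  · have hlt : lam < (core E Z t).card := by
      refine lt_of_le_of_ne hle fun h => ?_
      obtain ⟨i, hi⟩ := hi
      obtain ⟨f, hfP, hfc⟩ := hcore.exists_mem_arcsOf (hP.1.1 i)
      exact hi f (Finset.mem_filter.1 hfc).1 hfP ⟨_, hmin h.symm, hfc⟩
    exact Or.inl ⟨⟨hi, hlt⟩, fun h => hlt.ne' h.1⟩
  · refine Or.inr ⟨fun h => hi h.1, ?_⟩
    push Not at hi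
    choose e heZ heP heB using hi
    have heq := core_eq_of_bottleneck_choice hst hpb hP hself hZ heZ heP heB
    have hc : (core E Z t).card = lam := by
      refine le_antisymm ?_ hle
      rw [heq]
      simpa using Finset.card_image_le (s := (Finset.univ : Finset (Fin lam))) (f := e)
    refine ⟨hc, hmin hc, fun f hfZ hfc hfB => hfc ?_⟩
    obtain ⟨W, hW, hfW⟩ := id hfB
    obtain ⟨i, hfi⟩ := hP.exists_mem_arcsOf hW hfW
    have hupd : ∀ {p : Fin lam → V × V → Prop}, (∀ j, p j (e j)) → p i f →
        ∀ j, p j (Function.update e i f j) := by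
      intro p hp hpf j
      by_cases hj : j = i
      · subst hj; simpa using hpf
      · simpa [hj] using hp j
    rw [core_eq_of_bottleneck_choice hst hpb hP hself hZ (e := Function.update e i f)
      (hupd (p := fun _ a => a ∈ Z) heZ hfZ) (hupd (p := fun j a => a ∈ arcsOf (P j)) heP hfi)
      (hupd (p := fun _ a => Bottleneck E s t a) heB hfB)]
    exact Finset.mem_image.2 ⟨i, Finset.mem_univ _, by simp⟩

end FlowAug
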